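/- arXiv:2501.04396 — 3 statements merged into one kernel-verified Lean document; each statement's English description precedes it below -/
import Mathlib

section
/- Let n be a positive integer, r > 0, and let m = (m_p)_{p≥0} be a strongly regular sequence. Let A(z) be an n×n matrix whose entries are holomorphic functions on the disc D(0,r), and let y_0 ∈ ℂ^n. Then there exists R with 0 < R ≤ r such that the Cauchy problem ∂_m y = A(z) y, y(0) = y_0, admits a unique solution y = (y_1,…,y_n) with each component y_j holomorphic on D(0,R). -/
open scoped BigOperators

/-- A strongly regular sequence: a sequence of positive reals with `m 0 = 1` that is
logarithmically convex (lc), of moderate growth (mg), and satisfies the strong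
non-quasianalyticity condition (snq). -/
def StronglyRegularSeq (m : ℕ → ℝ) : Prop :=
  (∀ p, 0 < m p) ∧ m 0 = 1 ∧
  (∀ p : ℕ, 1 ≤ p → m p ^ 2 ≤ m (p - 1) * m (p + 1)) ∧
  (∃ A1 : ℝ, 0 < A1 ∧ ∀ p q : ℕ, m (p + q) ≤ A1 ^ (p + q) * (m p * m q)) ∧
  (∃ A2 : ℝ, 0 < A2 ∧ ∀ p : ℕ,
    ∑' q : ℕ, m (p + q) / (((p + q + 1 : ℕ) : ℝ) * m (p + q + 1)) ≤ A2 * (m p / m (p + 1)))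

/-- A solution on the disc `D(0,ρ)` of the moment-differential Cauchy problem
`∂ₘ y = A(z) y`, `y(0) = y₀`, described through its Taylor coefficients at the origin. -/
def IsMomentLinSol (m : ℕ → ℝ) {n : ℕ} (Acoef : ℕ → Matrix (Fin n) (Fin n) ℂ)
    (y₀ : Fin n → ℂ) (ρ : ℝ) (y : ℂ → Fin n → ℂ) : Prop :=
  ∃ c : ℕ → Fin n → ℂ,
    c 0 = y₀ ∧
    (∀ p : ℕ, ((m (p + 1) / m p : ℝ) : ℂ) • c (p + 1) =
      ∑ k ∈ Finset.range (p + 1), (Acoef (p - k)).mulVec (c k)) ∧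
    (∀ z ∈ Metric.ball (0 : ℂ) ρ, ∀ i, HasSum (fun p => c p i * z ^ p) (y z i))

/-- The Taylor coefficients of the formal solution of `∂ₘ y = A(z) y`, `y(0) = y₀`. -/
noncomputable def momentSolCoef (m : ℕ → ℝ) {n : ℕ} (Acoef : ℕ → Matrix (Fin n) (Fin n) ℂ)
    (y₀ : Fin n → ℂ) : ℕ → Fin n → ℂ
  | 0 => y₀
  | p + 1 => ((m p / m (p + 1) : ℝ) : ℂ) •
      ∑ k : Fin (p + 1), (Acoef (p - k)).mulVec (momentSolCoef m Acoef y₀ k)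
  decreasing_by exact k.2

theorem momentSolCoef_succ (m : ℕ → ℝ) {n : ℕ} (Acoef : ℕ → Matrix (Fin n) (Fin n) ℂ)
    (y₀ : Fin n → ℂ) (p : ℕ) :
    momentSolCoef m Acoef y₀ (p + 1) = ((m p / m (p + 1) : ℝ) : ℂ) •
      ∑ k ∈ Finset.range (p + 1), (Acoef (p - k)).mulVec (momentSolCoef m Acoef y₀ k) := by
  rw [momentSolCoef, Finset.sum_range]

/-- The coefficient recursion determines the formal solution. -/
theorem eq_momentSolCoef {m : ℕ → ℝ} (hpos : ∀ p, 0 < m p) {n : ℕ}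
    {Acoef : ℕ → Matrix (Fin n) (Fin n) ℂ} {y₀ : Fin n → ℂ} {c : ℕ → Fin n → ℂ}
    (h0 : c 0 = y₀)
    (hc : ∀ p : ℕ, ((m (p + 1) / m p : ℝ) : ℂ) • c (p + 1) =
      ∑ k ∈ Finset.range (p + 1), (Acoef (p - k)).mulVec (c k)) (p : ℕ) :
    c p = momentSolCoef m Acoef y₀ p := by
  induction p using Nat.strong_induction_on with
  | _ p ih =>
    cases p with
    | zero => rw [h0, momentSolCoef]
    | succ p =>
      have hsum : ∑ k ∈ Finset.range (p + 1), (Acoef (p - k)).mulVec (c k) =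
          ∑ k ∈ Finset.range (p + 1), (Acoef (p - k)).mulVec (momentSolCoef m Acoef y₀ k) :=
        Finset.sum_congr rfl fun k hk => by rw [ih k (Finset.mem_range.1 hk)]
      rw [momentSolCoef_succ, ← hsum, ← hc p, smul_smul, ← Complex.ofReal_mul,
        div_mul_div_cancel₀ (hpos _).ne', div_self (hpos _).ne', Complex.ofReal_one, one_smul]

/-- Logarithmic convexity bounds the quotients `m p / m (p + 1)`. -/
theorem div_succ_le_of_logConvex {m : ℕ → ℝ} (hpos : ∀ p, 0 < m p)
    (hlc : ∀ p : ℕ, 1 ≤ p → m p ^ 2 ≤ m (p - 1) * m (p + 1)) (p : ℕ) :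
    m p / m (p + 1) ≤ m 0 / m 1 := by
  induction p with
  | zero => exact le_rfl
  | succ p ih =>
    refine le_trans ?_ ih
    rw [div_le_div_iff₀ (hpos _) (hpos _), ← sq]
    exact hlc (p + 1) (by omega)

/-- Cauchy-type estimates, uniform in the entries, for a convergent matrix power series. -/
theorem exists_entry_bound {n : ℕ} {r : ℝ} (hr : 0 < r)
    {Acoef : ℕ → Matrix (Fin n) (Fin n) ℂ}
    (hAconv : ∀ z ∈ Metric.ball (0 : ℂ) r, ∀ i j, Summable fun p => Acoef p i j * z ^ p) :
    ∃ C K : ℝ, 0 ≤ C ∧ 0 < K ∧ ∀ p i j, ‖Acoef p i j‖ ≤ C * K ^ p := by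
  have hz : ((r / 2 : ℝ) : ℂ) ∈ Metric.ball (0 : ℂ) r := by
    rw [mem_ball_zero_iff, Complex.norm_real, Real.norm_of_nonneg (by positivity)]
    linarith
  have hb : ∀ i j, ∃ C, ∀ p, ‖Acoef p i j * ((r / 2 : ℝ) : ℂ) ^ p‖ ≤ C := fun i j => by
    obtain ⟨C, hC⟩ := (hAconv _ hz i j).tendsto_atTop_zero.norm.bddAbove_range
    exact ⟨C, fun p => hC ⟨p, rfl⟩⟩
  choose C hC using hb
  have hC0 : ∀ i j, 0 ≤ C i j := fun i j => (norm_nonneg _).trans (hC i j 0)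
  refine ⟨∑ i, ∑ j, C i j, (r / 2)⁻¹, Finset.sum_nonneg fun i _ =>
    Finset.sum_nonneg fun j _ => hC0 i j, by positivity, fun p i j => ?_⟩
  have h := hC i j p
  rw [norm_mul, norm_pow, Complex.norm_real, Real.norm_of_nonneg (by positivity)] at h
  rw [inv_pow, ← div_eq_mul_inv, le_div_iff₀ (by positivity)]
  refine h.trans ?_
  exact (Finset.single_le_sum (f := C i) (fun j _ => hC0 i j) (Finset.mem_univ j)).trans
    (Finset.single_le_sum (f := fun i => ∑ j, C i j)
      (fun i _ => Finset.sum_nonneg fun j _ => hC0 i j) (Finset.mem_univ i))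

/-- A matrix with entries bounded by `b` has sup-norm operator norm at most `n * b`. -/
theorem norm_mulVec_le_of_entry_le {n : ℕ} {M : Matrix (Fin n) (Fin n) ℂ} {b : ℝ} (hb : 0 ≤ b)
    (hM : ∀ i j, ‖M i j‖ ≤ b) (v : Fin n → ℂ) : ‖M.mulVec v‖ ≤ n * b * ‖v‖ := by
  refine (pi_norm_le_iff_of_nonneg (by positivity)).2 fun i => ?_
  calc ‖M.mulVec v i‖ ≤ ∑ j, ‖M i j * v j‖ := norm_sum_le Finset.univ fun j => M i j * v j
    _ ≤ ∑ _j : Fin n, b * ‖v‖ := by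
      refine Finset.sum_le_sum fun j _ => ?_
      rw [norm_mul]
      exact mul_le_mul (hM i j) (norm_le_pi_norm v j) (norm_nonneg _) hb
    _ = n * b * ‖v‖ := by simp [mul_assoc]

/-- Geometric growth of the formal solution, by majorisation. -/
theorem norm_momentSolCoef_le {m : ℕ → ℝ} (hpos : ∀ p, 0 < m p) {n : ℕ}
    {Acoef : ℕ → Matrix (Fin n) (Fin n) ℂ} {μ C K : ℝ} (hμ : ∀ p, m p / m (p + 1) ≤ μ)
    (hC : 0 ≤ C) (hK : 0 < K) (hA : ∀ p i j, ‖Acoef p i j‖ ≤ C * K ^ p)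
    (y₀ : Fin n → ℂ) (p : ℕ) :
    ‖momentSolCoef m Acoef y₀ p‖ ≤ ‖y₀‖ * (K + μ * (n * C)) ^ p := by
  have hμ0 : 0 ≤ μ := (div_pos (hpos 0) (hpos 1)).le.trans (hμ 0)
  set L := K + μ * (n * C) with hL
  have hL0 : 0 ≤ L := by positivity
  induction p using Nat.strong_induction_on with
  | _ p ih =>
    cases p with
    | zero => simp [momentSolCoef]
    | succ p =>
      have hgeom := geom_sum₂_mul L K (p + 1)
      have hLK : L - K = μ * (n * C) := by rw [hL]; ring
      rw [momentSolCoef_succ, norm_smul, Complex.norm_real,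
        Real.norm_of_nonneg (div_pos (hpos _) (hpos _)).le]
      calc m p / m (p + 1) * ‖∑ k ∈ Finset.range (p + 1),
            (Acoef (p - k)).mulVec (momentSolCoef m Acoef y₀ k)‖
          ≤ μ * ∑ k ∈ Finset.range (p + 1), n * (C * K ^ (p - k)) * (‖y₀‖ * L ^ k) := by
            refine mul_le_mul (hμ p) ((norm_sum_le _ _).trans ?_) (norm_nonneg _) hμ0
            refine Finset.sum_le_sum fun k hk => ?_
            refine (norm_mulVec_le_of_entry_le (by positivity) (hA (p - k)) _).trans ?_
            exact mul_le_mul_of_nonneg_left (ih k (Finset.mem_range.1 hk)) (by positivity)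
        _ = ‖y₀‖ * ((∑ k ∈ Finset.range (p + 1), L ^ k * K ^ (p + 1 - 1 - k)) * (L - K)) := by
            rw [hLK, Finset.sum_mul, Finset.mul_sum, Finset.mul_sum]
            refine Finset.sum_congr rfl fun k _ => ?_
            rw [Nat.add_sub_cancel]
            ring
        _ ≤ ‖y₀‖ * L ^ (p + 1) := by
            rw [hgeom]
            exact mul_le_mul_of_nonneg_left (sub_le_self _ (by positivity)) (norm_nonneg _)

/-- for a strongly regular moment sequence `m`, the Cauchy problem
`∂ₘ y = A(z) y`, `y(0) = y₀`, with `A(z)` holomorphic on `D(0,r)`, admits a unique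
solution, holomorphic on some disc `D(0,R)` with `0 < R ≤ r`. -/
theorem statement2 (n : ℕ) (hn : 0 < n) (r : ℝ) (hr : 0 < r)
    (m : ℕ → ℝ) (hm : StronglyRegularSeq m)
    (Acoef : ℕ → Matrix (Fin n) (Fin n) ℂ)
    (hAconv : ∀ z ∈ Metric.ball (0 : ℂ) r, ∀ i j, Summable fun p => Acoef p i j * z ^ p)
    (y₀ : Fin n → ℂ) :
    ∃ R : ℝ, 0 < R ∧ R ≤ r ∧
      ∃ y : ℂ → Fin n → ℂ,
        IsMomentLinSol m Acoef y₀ R y ∧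
        (∀ i, AnalyticOnNhd ℂ (fun z => y z i) (Metric.ball (0 : ℂ) R)) ∧
        ∀ y' : ℂ → Fin n → ℂ, IsMomentLinSol m Acoef y₀ R y' →
          ∀ z ∈ Metric.ball (0 : ℂ) R, y' z = y z := by
  obtain ⟨hpos, -, hlc, -, -⟩ := hm
  obtain ⟨C, K, hC, hK, hA⟩ := exists_entry_bound hr hAconv
  have hμ := div_succ_le_of_logConvex hpos hlc
  have hbound := norm_momentSolCoef_le hpos hμ hC hK hA y₀
  set L := K + m 0 / m 1 * (n * C)
  have hL : 0 < L := by
    have := div_pos (hpos 0) (hpos 1)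
    positivity
  set c := momentSolCoef m Acoef y₀ with hc
  set R := min r (2 * L)⁻¹
  have hterm : ∀ i p, ∀ z ∈ Metric.ball (0 : ℂ) R,
      ‖c p i * z ^ p‖ ≤ ‖y₀‖ * (1 / 2) ^ p := fun i p z hz => by
    have hzL : L * ‖z‖ ≤ 1 / 2 := by
      have h := (mem_ball_zero_iff.1 hz).le.trans (min_le_right _ _)
      calc L * ‖z‖ ≤ L * (2 * L)⁻¹ := mul_le_mul_of_nonneg_left h hL.le
        _ = 1 / 2 := by field_simp
    calc ‖c p i * z ^ p‖ ≤ ‖y₀‖ * L ^ p * ‖z‖ ^ p := by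
          rw [norm_mul, norm_pow]
          exact mul_le_mul_of_nonneg_right ((norm_le_pi_norm _ i).trans (hbound p))
            (by positivity)
      _ = ‖y₀‖ * (L * ‖z‖) ^ p := by rw [mul_pow, mul_assoc]
      _ ≤ ‖y₀‖ * (1 / 2) ^ p := by gcongr
  have hgeo : Summable fun p : ℕ => ‖y₀‖ * (1 / 2 : ℝ) ^ p :=
    summable_geometric_two.mul_left _
  have hsum : ∀ z ∈ Metric.ball (0 : ℂ) R, ∀ i, HasSum (fun p => c p i * z ^ p)
      (∑' p, c p i * z ^ p) := fun z hz i =>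
    (Summable.of_norm_bounded hgeo fun p => hterm i p z hz).hasSum
  refine ⟨R, lt_min hr (by positivity), min_le_left _ _, fun z i => ∑' p, c p i * z ^ p,
    ⟨c, by rw [hc, momentSolCoef], fun p => ?_, hsum⟩, fun i => ?_, ?_⟩
  · rw [hc, momentSolCoef_succ, smul_smul, ← Complex.ofReal_mul,
      div_mul_div_cancel₀ (hpos _).ne', div_self (hpos _).ne', Complex.ofReal_one, one_smul]
  · refine DifferentiableOn.analyticOnNhd ?_ Metric.isOpen_ball
    exact Complex.differentiableOn_tsum_of_summable_norm hgeo (fun p => by fun_prop)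
      Metric.isOpen_ball (hterm i)
  · rintro y' ⟨c', h0, hrec, hy'⟩ z hz
    funext i
    refine (hy' z hz i).unique ?_
    simpa only [eq_momentSolCoef hpos h0 hrec] using hsum z hz i
end

section
/- Let n be a positive integer, r > 0, and let m = (m_p)_{p≥0} be a sequence of positive real numbers with m_0 = 1 satisfying Assumption (A). Let A(z) be an n×n matrix and b(z) an n×1 vector whose entries are holomorphic functions on the disc D(0,r), and let y_0 ∈ ℂ^n. Then the Cauchy problem ∂_m y = A(z) y + b(z), y(0) = y_0, admits a unique solution y = (y_1,…,y_n) with each component y_j holomorphic on the whole disc D(0,r). -/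
open scoped BigOperators

/-- A solution on the disc `D(0,ρ)` of the nonhomogeneous moment-differential Cauchy
problem `∂ₘ y = A(z) y + b(z)`, `y(0) = y₀`, described through its Taylor coefficients:
`(m (p+1) / m p) • c (p+1) = ∑_{k=0}^p A_{p-k} (c k) + b_p`, `c 0 = y₀`. -/
def IsMomentLinSolNH (m : ℕ → ℝ) {n : ℕ} (Acoef : ℕ → Matrix (Fin n) (Fin n) ℂ)
    (bcoef : ℕ → Fin n → ℂ) (y₀ : Fin n → ℂ) (ρ : ℝ) (y : ℂ → Fin n → ℂ) : Prop :=
  ∃ c : ℕ → Fin n → ℂ,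
    c 0 = y₀ ∧
    (∀ p : ℕ, ((m (p + 1) / m p : ℝ) : ℂ) • c (p + 1) =
      (∑ k ∈ Finset.range (p + 1), (Acoef (p - k)).mulVec (c k)) + bcoef p) ∧
    (∀ z ∈ Metric.ball (0 : ℂ) ρ, ∀ i, HasSum (fun p => c p i * z ^ p) (y z i))

/-- The coefficients determined recursively by the moment-differential Cauchy problem. -/
noncomputable def momentSolCoeff (m : ℕ → ℝ) {n : ℕ} (Acoef : ℕ → Matrix (Fin n) (Fin n) ℂ)
    (bcoef : ℕ → Fin n → ℂ) (y₀ : Fin n → ℂ) : ℕ → Fin n → ℂ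
  | 0 => y₀
  | p + 1 => ((m (p + 1) / m p : ℝ) : ℂ)⁻¹ •
      ((∑ k : Fin (p + 1), (Acoef (p - k)).mulVec (momentSolCoeff m Acoef bcoef y₀ k)) + bcoef p)

theorem momentSolCoeff_recurrence {m : ℕ → ℝ} (hmpos : ∀ p, 0 < m p) {n : ℕ}
    (Acoef : ℕ → Matrix (Fin n) (Fin n) ℂ) (bcoef : ℕ → Fin n → ℂ) (y₀ : Fin n → ℂ) (p : ℕ) :
    ((m (p + 1) / m p : ℝ) : ℂ) • momentSolCoeff m Acoef bcoef y₀ (p + 1) =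
      (∑ k ∈ Finset.range (p + 1),
        (Acoef (p - k)).mulVec (momentSolCoeff m Acoef bcoef y₀ k)) + bcoef p := by
  have h : ((m (p + 1) / m p : ℝ) : ℂ) ≠ 0 :=
    Complex.ofReal_ne_zero.2 (div_pos (hmpos _) (hmpos _)).ne'
  rw [momentSolCoeff, smul_inv_smul₀ h, Finset.sum_range]

theorem eq_of_moment_recurrence {m : ℕ → ℝ} (hmpos : ∀ p, 0 < m p) {n : ℕ}
    {Acoef : ℕ → Matrix (Fin n) (Fin n) ℂ} {bcoef c c' : ℕ → Fin n → ℂ} (h0 : c 0 = c' 0)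
    (hc : ∀ p : ℕ, ((m (p + 1) / m p : ℝ) : ℂ) • c (p + 1) =
      (∑ k ∈ Finset.range (p + 1), (Acoef (p - k)).mulVec (c k)) + bcoef p)
    (hc' : ∀ p : ℕ, ((m (p + 1) / m p : ℝ) : ℂ) • c' (p + 1) =
      (∑ k ∈ Finset.range (p + 1), (Acoef (p - k)).mulVec (c' k)) + bcoef p) (p : ℕ) :
    c p = c' p := by
  induction p using Nat.strong_induction_on with
  | _ p ih =>
    cases p with
    | zero => exact h0
    | succ p =>
      have h : ((m (p + 1) / m p : ℝ) : ℂ) ≠ 0 :=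
        Complex.ofReal_ne_zero.2 (div_pos (hmpos _) (hmpos _)).ne'
      apply smul_right_injective _ h
      simp only [hc, hc']
      congr 1
      exact Finset.sum_congr rfl fun k hk => by rw [ih k (Finset.mem_range.1 hk)]

/-- A discrete Grönwall inequality with kernel `K / (p + 1)`, giving polynomial growth. -/
theorem one_add_sum_le_mul_pow {u : ℕ → ℝ} (hu : ∀ p, 0 ≤ u p) {K : ℕ}
    (h : ∀ p : ℕ, ((p : ℝ) + 1) * u (p + 1) ≤ K * (1 + ∑ k ∈ Finset.range (p + 1), u k)) (p : ℕ) :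
    1 + ∑ k ∈ Finset.range (p + 1), u k ≤ (1 + u 0) * ((p : ℝ) + 1) ^ K := by
  induction p with
  | zero => simp
  | succ p ih =>
    have hp : (0 : ℝ) < (p : ℝ) + 1 := by positivity
    have hbern : 1 + (K : ℝ) * (1 / ((p : ℝ) + 1)) ≤ (1 + 1 / ((p : ℝ) + 1)) ^ K :=
      one_add_mul_le_pow (by linarith [show (0 : ℝ) ≤ 1 / ((p : ℝ) + 1) by positivity]) K
    have hu0 := hu 0
    set U := 1 + ∑ k ∈ Finset.range (p + 1), u k
    have hU : 0 ≤ U := add_nonneg zero_le_one (Finset.sum_nonneg fun k _ => hu k)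
    have hnext : u (p + 1) ≤ K * (1 / ((p : ℝ) + 1)) * U := by
      have := (le_div_iff₀' hp).2 (h p)
      calc u (p + 1) ≤ K * U / ((p : ℝ) + 1) := this
        _ = _ := by ring
    calc 1 + ∑ k ∈ Finset.range (p + 1 + 1), u k = U + u (p + 1) := by
          rw [Finset.sum_range_succ _ (p + 1), ← add_assoc]
      _ ≤ (1 + (K : ℝ) * (1 / ((p : ℝ) + 1))) * U := by linarith
      _ ≤ (1 + 1 / ((p : ℝ) + 1)) ^ K * ((1 + u 0) * ((p : ℝ) + 1) ^ K) := by gcongr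
      _ = (1 + u 0) * ((1 + 1 / ((p : ℝ) + 1)) * ((p : ℝ) + 1)) ^ K := by rw [mul_pow]; ring
      _ = (1 + u 0) * (((p + 1 : ℕ) : ℝ) + 1) ^ K := by
          congr 2
          push_cast
          field_simp

/-- The terms of finitely many power series convergent at `s` are uniformly bounded. -/
theorem exists_norm_mul_pow_le {ι : Type*} [Finite ι] {a : ℕ → ι → ℂ} {s : ℝ} (hs : 0 ≤ s)
    (ha : ∀ i, Summable fun p => a p i * (s : ℂ) ^ p) :
    ∃ M : ℝ, 0 ≤ M ∧ ∀ p i, ‖a p i‖ * s ^ p ≤ M := by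
  have hbound : ∀ i, ∃ M : ℝ, ∀ p, ‖a p i‖ * s ^ p ≤ M := fun i => by
    obtain ⟨M, hM⟩ := (ha i).tendsto_atTop_zero.norm.bddAbove_range
    refine ⟨M, fun p => ?_⟩
    simpa [abs_of_nonneg hs] using hM ⟨p, rfl⟩
  choose M hM using hbound
  obtain ⟨N, hN⟩ := (Set.finite_range M).bddAbove
  exact ⟨max N 0, le_max_right _ _, fun p i =>
    (hM i p).trans ((hN ⟨i, rfl⟩).trans (le_max_left _ _))⟩

theorem norm_mulVec_le_of_norm_entry_le {n : ℕ} {A : Matrix (Fin n) (Fin n) ℂ} {M : ℝ} (hM0 : 0 ≤ M)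
    (hM : ∀ i j, ‖A i j‖ ≤ M) (v : Fin n → ℂ) : ‖A.mulVec v‖ ≤ n * M * ‖v‖ := by
  refine (pi_norm_le_iff_of_nonneg (by positivity)).2 fun i => ?_
  calc ‖∑ j, A i j * v j‖ ≤ ∑ j, ‖A i j * v j‖ := norm_sum_le _ _
    _ ≤ ∑ _j : Fin n, M * ‖v‖ := Finset.sum_le_sum fun j _ => by
        rw [norm_mul]
        exact mul_le_mul (hM i j) (norm_le_pi_norm v j) (norm_nonneg _) hM0
    _ = n * M * ‖v‖ := by simp [mul_assoc]

/-- Solutions of the moment recurrence have normal convergence on every smaller disc. -/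
theorem summable_norm_mul_pow_of_moment_recurrence {n : ℕ} {r : ℝ} {m : ℕ → ℝ}
    (hAssumpA : ∃ C : ℚ, 0 < C ∧ ∀ p : ℕ, 1 ≤ p → (p : ℝ) / (C : ℝ) ≤ m p / m (p - 1))
    {Acoef : ℕ → Matrix (Fin n) (Fin n) ℂ}
    (hAconv : ∀ z ∈ Metric.ball (0 : ℂ) r, ∀ i j, Summable fun p => Acoef p i j * z ^ p)
    {bcoef : ℕ → Fin n → ℂ}
    (hbconv : ∀ z ∈ Metric.ball (0 : ℂ) r, ∀ i, Summable fun p => bcoef p i * z ^ p)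
    {c : ℕ → Fin n → ℂ}
    (hc : ∀ p : ℕ, ((m (p + 1) / m p : ℝ) : ℂ) • c (p + 1) =
      (∑ k ∈ Finset.range (p + 1), (Acoef (p - k)).mulVec (c k)) + bcoef p)
    {t : ℝ} (ht : 0 ≤ t) (htr : t < r) : Summable fun p => ‖c p‖ * t ^ p := by
  obtain ⟨s, hts, hsr⟩ := exists_between htr
  have hs : 0 < s := ht.trans_lt hts
  have hsball : (s : ℂ) ∈ Metric.ball (0 : ℂ) r := by simpa [abs_of_pos hs] using hsr
  obtain ⟨C, hC, hmC⟩ := hAssumpA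
  have hC' : (0 : ℝ) < C := by exact_mod_cast hC
  obtain ⟨M, hM0, hM⟩ := exists_norm_mul_pow_le (a := fun p (ij : Fin n × Fin n) =>
    Acoef p ij.1 ij.2) hs.le fun ij => hAconv s hsball ij.1 ij.2
  obtain ⟨B, hB0, hB⟩ := exists_norm_mul_pow_le hs.le (hbconv s hsball)
  have hAnorm : ∀ p v, ‖(Acoef p).mulVec v‖ * s ^ p ≤ n * M * ‖v‖ := fun p v => by
    have hsp : 0 < s ^ p := pow_pos hs p
    have := norm_mulVec_le_of_norm_entry_le (div_nonneg hM0 hsp.le)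
      (fun i j => (le_div_iff₀ hsp).2 (hM p (i, j))) v
    calc _ ≤ n * (M / s ^ p) * ‖v‖ * s ^ p := by gcongr
      _ = _ := by field_simp
  have hbnorm : ∀ p, ‖bcoef p‖ * s ^ p ≤ B := fun p => by
    rw [← le_div_iff₀ (pow_pos hs p)]
    exact (pi_norm_le_iff_of_nonneg (by positivity)).2 fun i =>
      (le_div_iff₀ (pow_pos hs p)).2 (hB p i)
  obtain ⟨K, hK⟩ := exists_nat_ge (C * s * (n * M + B))
  have hrec : ∀ p : ℕ, ((p : ℝ) + 1) * (‖c (p + 1)‖ * s ^ (p + 1)) ≤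
      K * (1 + ∑ k ∈ Finset.range (p + 1), ‖c k‖ * s ^ k) := fun p => by
    have hS : 0 ≤ ∑ k ∈ Finset.range (p + 1), ‖c k‖ * s ^ k :=
      Finset.sum_nonneg fun k _ => by positivity
    have hq : ((p : ℝ) + 1) / C ≤ m (p + 1) / m p := by simpa using hmC (p + 1) (by omega)
    have hq0 : 0 ≤ m (p + 1) / m p := le_trans (by positivity) hq
    have hnorm : m (p + 1) / m p * ‖c (p + 1)‖ ≤
        (∑ k ∈ Finset.range (p + 1), ‖(Acoef (p - k)).mulVec (c k)‖) + ‖bcoef p‖ := by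
      calc m (p + 1) / m p * ‖c (p + 1)‖ = ‖((m (p + 1) / m p : ℝ) : ℂ) • c (p + 1)‖ := by
            rw [norm_smul, Complex.norm_real, Real.norm_of_nonneg hq0]
        _ ≤ _ := by
            rw [hc]
            exact (norm_add_le _ _).trans (by gcongr; exact norm_sum_le _ _)
    have hweighted : ((∑ k ∈ Finset.range (p + 1), ‖(Acoef (p - k)).mulVec (c k)‖) + ‖bcoef p‖) *
        s ^ p ≤ n * M * (∑ k ∈ Finset.range (p + 1), ‖c k‖ * s ^ k) + B := by
      rw [add_mul, Finset.sum_mul, Finset.mul_sum]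
      refine add_le_add (Finset.sum_le_sum fun k hk => ?_) (hbnorm p)
      have hkp : p - k + k = p := Nat.sub_add_cancel (Finset.mem_range_succ_iff.1 hk)
      calc ‖(Acoef (p - k)).mulVec (c k)‖ * s ^ p
          = ‖(Acoef (p - k)).mulVec (c k)‖ * s ^ (p - k) * s ^ k := by
            rw [mul_assoc, ← pow_add, hkp]
        _ ≤ n * M * ‖c k‖ * s ^ k :=
            mul_le_mul_of_nonneg_right (hAnorm _ _) (by positivity)
        _ = _ := by ring
    set S := ∑ k ∈ Finset.range (p + 1), ‖c k‖ * s ^ k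
    calc ((p : ℝ) + 1) * (‖c (p + 1)‖ * s ^ (p + 1))
        = C * s * (((p : ℝ) + 1) / C * ‖c (p + 1)‖ * s ^ p) := by field_simp; ring
      _ ≤ C * s * (m (p + 1) / m p * ‖c (p + 1)‖ * s ^ p) := by gcongr
      _ ≤ C * s * (n * M * S + B) := by
          gcongr
          exact (mul_le_mul_of_nonneg_right hnorm (by positivity)).trans hweighted
      _ ≤ C * s * ((n * M + B) * (1 + S)) := by
          gcongr
          have h₁ : 0 ≤ (n : ℝ) * M := by positivity
          nlinarith [mul_nonneg hB0 hS]
      _ = C * s * (n * M + B) * (1 + S) := by ring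
      _ ≤ K * (1 + S) := by gcongr
  have hgrowth := one_add_sum_le_mul_pow (u := fun k => ‖c k‖ * s ^ k)
    (fun p => by positivity) hrec
  have hterm : ∀ p : ℕ, ‖c p‖ * s ^ p ≤ (1 + ‖c 0‖) * ((p : ℝ) + 1) ^ K := fun p => by
    have h₁ : ‖c p‖ * s ^ p ≤ ∑ k ∈ Finset.range (p + 1), ‖c k‖ * s ^ k :=
      Finset.single_le_sum (f := fun k => ‖c k‖ * s ^ k) (fun k _ => by positivity)
        (Finset.self_mem_range_succ p)
    have h₂ := hgrowth p
    simp only [pow_zero, mul_one] at h₂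
    linarith
  have hratio : t / s < 1 := (div_lt_one hs).2 hts
  have hgeom : Summable fun p : ℕ => ((p : ℝ) + 1) ^ K * (t / s) ^ p := by
    have := summable_pow_mul_geometric_of_norm_lt_one (R := ℝ) K (r := t / s)
      (by rwa [Real.norm_of_nonneg (by positivity)])
    refine Summable.of_nonneg_of_le (fun p => by positivity) (fun p => ?_)
      (((this.mul_left (2 ^ K)).add
        (summable_geometric_of_lt_one (by positivity) hratio)))
    rcases Nat.eq_zero_or_pos p with rfl | hp
    · simp only [Nat.cast_zero, zero_add, one_pow, pow_zero, mul_one]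
      linarith [show (0 : ℝ) ≤ 2 ^ K * 0 ^ K by positivity]
    · have hp' : (1 : ℝ) ≤ p := by exact_mod_cast hp
      calc ((p : ℝ) + 1) ^ K * (t / s) ^ p ≤ (2 * p) ^ K * (t / s) ^ p := by
            gcongr
            linarith
        _ = 2 ^ K * (p ^ K * (t / s) ^ p) := by rw [mul_pow]; ring
        _ ≤ _ := le_add_of_nonneg_right (by positivity)
  refine Summable.of_nonneg_of_le (fun p => by positivity) (fun p => ?_)
    (hgeom.mul_left (1 + ‖c 0‖))
  calc ‖c p‖ * t ^ p = ‖c p‖ * s ^ p * (t / s) ^ p := by rw [div_pow]; field_simp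
    _ ≤ (1 + ‖c 0‖) * ((p : ℝ) + 1) ^ K * (t / s) ^ p :=
        mul_le_mul_of_nonneg_right (hterm p) (by positivity)
    _ = _ := by ring

theorem analyticOnNhd_tsum_mul_pow {a : ℕ → ℂ} {r : ℝ}
    (ha : ∀ t : ℝ, 0 ≤ t → t < r → Summable fun p => ‖a p‖ * t ^ p) :
    AnalyticOnNhd ℂ (fun z => ∑' p, a p * z ^ p) (Metric.ball (0 : ℂ) r) := by
  intro z hz
  obtain ⟨t, hzt, htr⟩ := exists_between (mem_ball_zero_iff.1 hz)
  have ht : 0 ≤ t := (norm_nonneg z).trans hzt.le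
  refine (Complex.differentiableOn_tsum_of_summable_norm (ha t ht htr)
    (fun p => by fun_prop) Metric.isOpen_ball fun p w hw => ?_).analyticAt
    (Metric.isOpen_ball.mem_nhds (mem_ball_zero_iff.2 hzt))
  rw [norm_mul, norm_pow]
  gcongr
  exact (mem_ball_zero_iff.1 hw).le

/-- under Assumption (A) on the moment sequence `m`, the Cauchy problem
`∂ₘ y = A(z) y + b(z)`, `y(0) = y₀`, with `A(z)` and `b(z)` holomorphic on `D(0,r)`,
admits a unique solution, holomorphic on the whole disc `D(0,r)`. -/
theorem statement5 (n : ℕ) (hn : 0 < n) (r : ℝ) (hr : 0 < r)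
    (m : ℕ → ℝ) (hmpos : ∀ p, 0 < m p) (hm0 : m 0 = 1)
    (hAssumpA : ∃ C : ℚ, 0 < C ∧ ∀ p : ℕ, 1 ≤ p → (p : ℝ) / (C : ℝ) ≤ m p / m (p - 1))
    (Acoef : ℕ → Matrix (Fin n) (Fin n) ℂ)
    (hAconv : ∀ z ∈ Metric.ball (0 : ℂ) r, ∀ i j, Summable fun p => Acoef p i j * z ^ p)
    (bcoef : ℕ → Fin n → ℂ)
    (hbconv : ∀ z ∈ Metric.ball (0 : ℂ) r, ∀ i, Summable fun p => bcoef p i * z ^ p)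
    (y₀ : Fin n → ℂ) :
    ∃ y : ℂ → Fin n → ℂ,
      IsMomentLinSolNH m Acoef bcoef y₀ r y ∧
      (∀ i, AnalyticOnNhd ℂ (fun z => y z i) (Metric.ball (0 : ℂ) r)) ∧
      ∀ y' : ℂ → Fin n → ℂ, IsMomentLinSolNH m Acoef bcoef y₀ r y' →
        ∀ z ∈ Metric.ball (0 : ℂ) r, y' z = y z := by
  set c := momentSolCoeff m Acoef bcoef y₀ with hcdef
  have hc0 : c 0 = y₀ := by rw [hcdef, momentSolCoeff]
  have hc := momentSolCoeff_recurrence hmpos Acoef bcoef y₀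
  have hsum : ∀ i (t : ℝ), 0 ≤ t → t < r → Summable fun p => ‖c p i‖ * t ^ p := fun i t ht htr =>
    Summable.of_nonneg_of_le (fun p => by positivity)
      (fun p => mul_le_mul_of_nonneg_right (norm_le_pi_norm (c p) i) (by positivity))
      (summable_norm_mul_pow_of_moment_recurrence hAssumpA hAconv hbconv hc ht htr)
  have hHasSum : ∀ z ∈ Metric.ball (0 : ℂ) r, ∀ i,
      HasSum (fun p => c p i * z ^ p) (∑' p, c p i * z ^ p) := fun z hz i =>
    (Summable.of_norm (by
      simpa only [norm_mul, norm_pow] using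
        hsum i ‖z‖ (norm_nonneg z) (mem_ball_zero_iff.1 hz))).hasSum
  refine ⟨fun z i => ∑' p, c p i * z ^ p, ⟨c, hc0, hc, hHasSum⟩,
    fun i => analyticOnNhd_tsum_mul_pow (hsum i), ?_⟩
  rintro y' ⟨c', hc'0, hc', hy'⟩ z hz
  obtain rfl : c' = c := funext (eq_of_moment_recurrence hmpos (hc'0.trans hc0.symm) hc' hc)
  funext i
  exact (hy' z hz i).unique (hHasSum z hz i)
end

section
/- Let m = (m_p)_{p≥0} be a sequence of positive real numbers with m_0 = 1 for which there exist α, C > 0 with m_{p+1}/m_p ≥ C (p+1)^α for all p ≥ 0. Let k be a positive integer, A ∈ ℂ^{n×n}, and y_0 ∈ ℂ^n. Then the series y(z) = ∑_{p≥0} (∏_{j=1}^{p} m_{j(k+1)−1}/m_{j(k+1)}) A^p y_0 z^{(k+1)p} converges absolutely and uniformly on compact subsets of ℂ; in particular it defines a vector of entire functions, and it is the unique solution of the Cauchy problem ∂_m y = z^k A y, y(0) = y_0. -/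
open scoped BigOperators

/-- A solution (given by an everywhere-convergent Taylor series, i.e. a vector of entire
functions) of the Cauchy problem `∂ₘ y = z^k A y`, `y(0) = y₀`: the Taylor coefficients
`c p` satisfy `(m (p+1)/m p) • c (p+1) = A (c (p-k))` for `p ≥ k`, and
`(m (p+1)/m p) • c (p+1) = 0` for `p < k`, with `c 0 = y₀`. -/
def IsMomentMonomialSol (m : ℕ → ℝ) {n : ℕ} (k : ℕ) (A : Matrix (Fin n) (Fin n) ℂ)
    (y₀ : Fin n → ℂ) (y : ℂ → Fin n → ℂ) : Prop :=
  ∃ c : ℕ → Fin n → ℂ,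
    c 0 = y₀ ∧
    (∀ p : ℕ, k ≤ p → ((m (p + 1) / m p : ℝ) : ℂ) • c (p + 1) = A.mulVec (c (p - k))) ∧
    (∀ p : ℕ, p < k → ((m (p + 1) / m p : ℝ) : ℂ) • c (p + 1) = 0) ∧
    ∀ (z : ℂ) (i : Fin n), HasSum (fun p => c p i * z ^ p) (y z i)

/-- The `p`-th coefficient, in powers of `z ^ (k + 1)`, of the solution of the Cauchy problem. -/
noncomputable def momentCoeff (m : ℕ → ℝ) {n : ℕ} (k : ℕ) (A : Matrix (Fin n) (Fin n) ℂ)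
    (y₀ : Fin n → ℂ) (p : ℕ) : Fin n → ℂ :=
  (((∏ j ∈ Finset.range p, m ((j + 1) * (k + 1) - 1) / m ((j + 1) * (k + 1)) : ℝ)) : ℂ) •
    ((A ^ p).mulVec y₀)

theorem momentCoeff_zero (m : ℕ → ℝ) {n : ℕ} (k : ℕ) (A : Matrix (Fin n) (Fin n) ℂ)
    (y₀ : Fin n → ℂ) : momentCoeff m k A y₀ 0 = y₀ := by
  simp [momentCoeff]

theorem momentCoeff_succ (m : ℕ → ℝ) {n : ℕ} (k : ℕ) (A : Matrix (Fin n) (Fin n) ℂ)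
    (y₀ : Fin n → ℂ) (p : ℕ) :
    momentCoeff m k A y₀ (p + 1) =
      ((m ((p + 1) * (k + 1) - 1) / m ((p + 1) * (k + 1)) : ℝ) : ℂ) •
        A.mulVec (momentCoeff m k A y₀ p) := by
  simp only [momentCoeff, Finset.prod_range_succ, Matrix.mulVec_smul, smul_smul, pow_succ',
    Matrix.mulVec_mulVec]
  push_cast
  rw [mul_comm]

theorem tendsto_div_succ_zero_of_rpow_le {m : ℕ → ℝ} {α C : ℝ} (hα : 0 < α) (hC : 0 < C)
    (hgrow : ∀ p : ℕ, C * ((p : ℝ) + 1) ^ α ≤ m (p + 1) / m p) :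
    Filter.Tendsto (fun p => m p / m (p + 1)) Filter.atTop (nhds 0) := by
  have h1 : Filter.Tendsto (fun p : ℕ => C * ((p : ℝ) + 1) ^ α) Filter.atTop Filter.atTop :=
    ((tendsto_rpow_atTop hα).comp
      (Filter.tendsto_atTop_add_const_right _ 1 tendsto_natCast_atTop_atTop)).const_mul_atTop hC
  refine ((Filter.tendsto_atTop_mono hgrow h1).inv_tendsto_atTop).congr fun p => ?_
  simp

theorem summable_pow_mul_norm_momentCoeff {m : ℕ → ℝ} {n : ℕ} {α C : ℝ} (hα : 0 < α) (hC : 0 < C)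
    (hgrow : ∀ p : ℕ, C * ((p : ℝ) + 1) ^ α ≤ m (p + 1) / m p)
    (k : ℕ) (A : Matrix (Fin n) (Fin n) ℂ) (y₀ : Fin n → ℂ) (R : ℝ) :
    Summable fun p => R ^ ((k + 1) * p) * ‖momentCoeff m k A y₀ p‖ := by
  set L := LinearMap.toContinuousLinearMap A.mulVecLin
  have hL (v : Fin n → ℂ) : ‖A.mulVec v‖ ≤ ‖L‖ * ‖v‖ := L.le_opNorm v
  have hsub : Filter.Tendsto (fun p : ℕ => p * (k + 1) + k) Filter.atTop Filter.atTop :=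
    Filter.tendsto_atTop_mono (fun p => by simp only [id]; nlinarith [Nat.zero_le (p * k)]) Filter.tendsto_id
  have hlim := (((tendsto_div_succ_zero_of_rpow_le hα hC hgrow).comp hsub).norm).const_mul
    (|R| ^ (k + 1) * ‖L‖)
  rw [norm_zero, mul_zero] at hlim
  refine summable_of_ratio_norm_eventually_le (r := 1 / 2) (by norm_num) ?_
  filter_upwards [hlim.eventually_le_const (by norm_num : (0 : ℝ) < 1 / 2)] with p hp
  have h1 : (p + 1) * (k + 1) - 1 = p * (k + 1) + k := by
    rw [add_mul]; omega
  have h2 : (p + 1) * (k + 1) = p * (k + 1) + k + 1 := by ring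
  rw [momentCoeff_succ, h1, h2, norm_mul, norm_mul, norm_norm, norm_norm, norm_smul,
    Complex.norm_real, norm_pow, norm_pow, Real.norm_eq_abs R, mul_add, pow_add, mul_one]
  simp only [Function.comp_apply] at hp
  set q := ‖m (p * (k + 1) + k) / m (p * (k + 1) + k + 1)‖
  set v := momentCoeff m k A y₀ p
  calc |R| ^ ((k + 1) * p) * |R| ^ (k + 1) * (q * ‖A.mulVec v‖)
      ≤ |R| ^ ((k + 1) * p) * |R| ^ (k + 1) * (q * (‖L‖ * ‖v‖)) := by
        gcongr
        exact hL v
    _ = |R| ^ (k + 1) * ‖L‖ * q * (|R| ^ ((k + 1) * p) * ‖v‖) := by ring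
    _ ≤ 1 / 2 * (|R| ^ ((k + 1) * p) * ‖v‖) := by gcongr

/-- The Taylor coefficients of a solution are determined by the recursion. -/
theorem eq_of_moment_recursion {m : ℕ → ℝ} (hmpos : ∀ p, 0 < m p) {n k : ℕ}
    {A : Matrix (Fin n) (Fin n) ℂ} {c d : ℕ → Fin n → ℂ} (h0 : c 0 = d 0)
    (hc : ∀ p, k ≤ p → ((m (p + 1) / m p : ℝ) : ℂ) • c (p + 1) = A.mulVec (c (p - k)))
    (hc' : ∀ p, p < k → ((m (p + 1) / m p : ℝ) : ℂ) • c (p + 1) = 0)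
    (hd : ∀ p, k ≤ p → ((m (p + 1) / m p : ℝ) : ℂ) • d (p + 1) = A.mulVec (d (p - k)))
    (hd' : ∀ p, p < k → ((m (p + 1) / m p : ℝ) : ℂ) • d (p + 1) = 0) : c = d := by
  funext p
  induction p using Nat.strong_induction_on with
  | _ p ih =>
    cases p with
    | zero => exact h0
    | succ p =>
      have hne : ((m (p + 1) / m p : ℝ) : ℂ) ≠ 0 :=
        Complex.ofReal_ne_zero.2 (div_pos (hmpos _) (hmpos _)).ne'
      refine smul_right_injective _ hne ?_
      rcases lt_or_ge p k with h | h
      · exact (hc' p h).trans (hd' p h).symm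
      · exact (hc p h).trans ((congrArg _ (ih (p - k) (by omega))).trans (hd p h).symm)

theorem isMomentMonomialSol_of_hasSum {m : ℕ → ℝ} (hmpos : ∀ p, 0 < m p) {n k : ℕ}
    {A : Matrix (Fin n) (Fin n) ℂ} {y₀ : Fin n → ℂ} {y : ℂ → Fin n → ℂ}
    (hy : ∀ z, HasSum (fun p => z ^ ((k + 1) * p) • momentCoeff m k A y₀ p) (y z)) :
    IsMomentMonomialSol m k A y₀ y := by
  refine ⟨fun q => if k + 1 ∣ q then momentCoeff m k A y₀ (q / (k + 1)) else 0, ?_, ?_, ?_, ?_⟩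
  · simp [momentCoeff_zero]
  · intro p hp
    obtain ⟨q, rfl⟩ := Nat.exists_eq_add_of_le' hp
    simp only [Nat.add_sub_cancel, add_assoc q k 1, Nat.dvd_add_self_right]
    split_ifs with h
    · obtain ⟨s, rfl⟩ := h
      have h1 : ((k + 1) * s + (k + 1)) / (k + 1) = s + 1 := by
        rw [Nat.add_div_right _ k.succ_pos, Nat.mul_div_cancel_left _ k.succ_pos]
      have h2 : (s + 1) * (k + 1) - 1 = (k + 1) * s + k := by
        rw [add_mul, mul_comm s]; omega
      have h3 : (s + 1) * (k + 1) = (k + 1) * s + (k + 1) := by ring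
      rw [h1, Nat.mul_div_cancel_left _ k.succ_pos, momentCoeff_succ, h2, h3, smul_smul,
        ← Complex.ofReal_mul, div_mul_div_cancel₀ (hmpos _).ne', div_self (hmpos _).ne',
        Complex.ofReal_one, one_smul]
    · simp
  · intro p hp
    have h : ¬ k + 1 ∣ p + 1 := fun h => absurd (Nat.le_of_dvd p.succ_pos h) (by omega)
    simp only [if_neg h, smul_zero]
  · intro z i
    have hinj : Function.Injective fun p : ℕ => (k + 1) * p :=
      fun _ _ h => Nat.eq_of_mul_eq_mul_left k.succ_pos h
    rw [← hinj.hasSum_iff]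
    · refine (Pi.hasSum.1 (hy z) i).congr_fun fun p => ?_
      simp [mul_comm]
    · intro q hq
      have h : ¬ k + 1 ∣ q := fun ⟨s, hs⟩ => hq ⟨s, hs.symm⟩
      simp only [if_neg h, Pi.zero_apply, zero_mul]

/-- if `m (p+1) / m p ≥ C (p+1)^α` for some `α, C > 0`, then the series
`y(z) = ∑_{p≥0} (∏_{j=1}^p m_{j(k+1)-1}/m_{j(k+1)}) A^p y₀ z^{(k+1)p}` converges
absolutely and uniformly on compact subsets of `ℂ`, defines a vector of entire
functions, and is the unique solution of `∂ₘ y = z^k A y`, `y(0) = y₀`. -/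
theorem statement7 (n : ℕ) (m : ℕ → ℝ) (hmpos : ∀ p, 0 < m p) (hm0 : m 0 = 1)
    (α C : ℝ) (hα : 0 < α) (hC : 0 < C)
    (hgrow : ∀ p : ℕ, C * ((p : ℝ) + 1) ^ α ≤ m (p + 1) / m p)
    (k : ℕ) (hk : 0 < k) (A : Matrix (Fin n) (Fin n) ℂ) (y₀ : Fin n → ℂ) :
    let c : ℕ → Fin n → ℂ := fun p =>
      (((∏ j ∈ Finset.range p, m ((j + 1) * (k + 1) - 1) / m ((j + 1) * (k + 1)) : ℝ)) : ℂ) •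
        ((A ^ p).mulVec y₀)
    let f : ℕ → ℂ → Fin n → ℂ := fun p z => z ^ ((k + 1) * p) • c p
    let y : ℂ → Fin n → ℂ := fun z => ∑' p, f p z
    (∀ z : ℂ, Summable fun p => ‖f p z‖) ∧
    (∀ K : Set ℂ, IsCompact K →
      TendstoUniformlyOn (fun N z => ∑ p ∈ Finset.range N, f p z) y Filter.atTop K) ∧
    (∀ i, AnalyticOnNhd ℂ (fun z => y z i) Set.univ) ∧
    IsMomentMonomialSol m k A y₀ y ∧
    ∀ y' : ℂ → Fin n → ℂ, IsMomentMonomialSol m k A y₀ y' → y' = y := by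
  intro c f y
  have hsum (R : ℝ) : Summable fun p => R ^ ((k + 1) * p) * ‖c p‖ :=
    summable_pow_mul_norm_momentCoeff hα hC hgrow k A y₀ R
  have hnorm (z : ℂ) : Summable fun p => ‖f p z‖ :=
    (hsum ‖z‖).congr fun p => by simp only [f, norm_smul (_ ^ _) (c p), norm_pow]
  have hunif (K : Set ℂ) (hK : IsCompact K) :
      TendstoUniformlyOn (fun N z => ∑ p ∈ Finset.range N, f p z) y Filter.atTop K := by
    obtain ⟨R, hR⟩ := hK.isBounded.exists_norm_le
    refine tendstoUniformlyOn_tsum_nat (hsum R) fun p z hz => ?_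
    rw [norm_smul, norm_pow]
    gcongr
    exact hR z hz
  have hdiff : DifferentiableOn ℂ y Set.univ := by
    refine ((tendstoLocallyUniformlyOn_iff_forall_isCompact isOpen_univ).2
      fun K _ hK => hunif K hK).differentiableOn (.of_forall fun N => ?_) isOpen_univ
    fun_prop
  have hsol : IsMomentMonomialSol m k A y₀ y :=
    isMomentMonomialSol_of_hasSum hmpos fun z => (hnorm z).of_norm.hasSum
  refine ⟨hnorm, hunif, fun i => (differentiableOn_pi.1 hdiff i).analyticOnNhd isOpen_univ, hsol,
    fun y' ⟨d, hd0, hd, hd', hdy⟩ => ?_⟩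
  obtain ⟨e, he0, he, he', hey⟩ := hsol
  obtain rfl := eq_of_moment_recursion hmpos (hd0.trans he0.symm) hd hd' he he'
  funext z i
  exact (hdy z i).unique (hey z i)
end
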